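/- Let N ≥ 3 and 0 < μ < μ₀ = (N-2)²/4. Then for every x ∈ ℝ^N∖{0}, |x|^{τ₋(μ)} = μ c_N ∫_{ℝ^N} |y|^{τ₋(μ)-2} |x - y|^{2-N} dy, where c_N = ((N-2)|𝕊^{N-1}|)^{-1}; in particular the integral on the right-hand side is finite for every x ≠ 0. -/

import Mathlib

open Filter MeasureTheory Metric

noncomputable section

/-- Euclidean space ℝ^N. -/
abbrev Euc (N : ℕ) : Type := EuclideanSpace ℝ (Fin N)

/-- The Laplacian of `u` at `x`, as the sum of the pure second derivatives in the
coordinate directions. -/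
def lap {N : ℕ} (u : Euc N → ℝ) (x : Euc N) : ℝ :=
  ∑ i : Fin N, fderiv ℝ (fun y => fderiv ℝ u y (EuclideanSpace.single i 1)) x
    (EuclideanSpace.single i 1)

/-- μ₀ = (N-2)²/4. -/
def mu0 (N : ℕ) : ℝ := ((N : ℝ) - 2) ^ 2 / 4

/-- τ₋(μ) = -(N-2)/2 - √(μ₀-μ). -/
def tauMinus (N : ℕ) (μ : ℝ) : ℝ := -((N : ℝ) - 2) / 2 - Real.sqrt (mu0 N - μ)

/-- τ₊(μ) = -(N-2)/2 + √(μ₀-μ). -/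
def tauPlus (N : ℕ) (μ : ℝ) : ℝ := -((N : ℝ) - 2) / 2 + Real.sqrt (mu0 N - μ)

/-- Surface area of the unit sphere in ℝ^N, i.e. N times the volume of the unit ball. -/
def sphereArea (N : ℕ) : ℝ := N * (volume (ball (0 : Euc N) 1)).toReal

/-- The normalizing constant c_μ: 2√(μ₀-μ)|𝕊^{N-1}| for μ < μ₀ and |𝕊^{N-1}| for μ = μ₀. -/
def cMu (N : ℕ) (μ : ℝ) : ℝ :=
  if μ < mu0 N then 2 * Real.sqrt (mu0 N - μ) * sphereArea N else sphereArea N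

/-- The normalizing constant c_N = ((N-2)|𝕊^{N-1}|)⁻¹ of the fundamental solution of -Δ. -/
def cN (N : ℕ) : ℝ := (((N : ℝ) - 2) * sphereArea N)⁻¹

/-- The singular profile Φ_μ: |x|^{τ₋(μ)} for μ < μ₀ and |x|^{-(N-2)/2}(-ln|x|) for μ = μ₀. -/
def PhiFun (N : ℕ) (μ : ℝ) (x : Euc N) : ℝ :=
  if μ < mu0 N then ‖x‖ ^ tauMinus N μ
  else ‖x‖ ^ (-((N : ℝ) - 2) / 2) * (-Real.log ‖x‖)

/-- The adjoint operator L*_μ ξ(x) = -Δξ(x) - 2τ₊(μ)|x|⁻² x·∇ξ(x). -/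
def LstarMu (N : ℕ) (μ : ℝ) (ξ : Euc N → ℝ) (x : Euc N) : ℝ :=
  -lap ξ x - 2 * tauPlus N μ / ‖x‖ ^ 2 * fderiv ℝ ξ x x

/-- The adjoint operator L*_{μV} ξ = L*_μ ξ - μ(V - |x|⁻²)ξ. -/
def LstarMuV (N : ℕ) (μ : ℝ) (V ξ : Euc N → ℝ) (x : Euc N) : ℝ :=
  LstarMu N μ ξ x - μ * (V x - ‖x‖ ^ (-2 : ℝ)) * ξ x

/-- A compactly supported C^{1,1} test function: compactly supported, differentiable,
with Lipschitz gradient. -/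
def IsC11c {N : ℕ} (ξ : Euc N → ℝ) : Prop :=
  HasCompactSupport ξ ∧ Differentiable ℝ ξ ∧ ∃ L : NNReal, LipschitzWith L (fderiv ℝ ξ)

/-- The dμ-distributional identity with constant `k`. -/
def DistribIdentity (N : ℕ) (μ : ℝ) (V u : Euc N → ℝ) (k : ℝ) : Prop :=
  ∀ ξ : Euc N → ℝ, IsC11c ξ →
    ∫ x : Euc N, u x * LstarMuV N μ V ξ x * ‖x‖ ^ tauPlus N μ = cMu N μ * k * ξ 0

/-- `u` is a classical solution of -Δu - μVu = 0 in ℝ^N∖{0}. -/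
def IsSolution (N : ℕ) (μ : ℝ) (V u : Euc N → ℝ) : Prop :=
  ContDiffOn ℝ 2 u {x : Euc N | x ≠ 0} ∧
  ∀ x : Euc N, x ≠ 0 → -lap u x - μ * V x * u x = 0

/-- `f` is locally γ-Hölder continuous on `s`. -/
def LocHolderOn {N : ℕ} (γ : ℝ) (s : Set (Euc N)) (f : Euc N → ℝ) : Prop :=
  ∀ x ∈ s, ∃ ε > 0, ∃ C > 0, ∀ y ∈ ball x ε ∩ s, ∀ z ∈ ball x ε ∩ s,
    |f y - f z| ≤ C * dist y z ^ γ

/-- The filter `‖x‖ → +∞` on ℝ^N. -/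
def normAtTop (N : ℕ) : Filter (Euc N) := comap norm atTop

/-- Assumption (V): V is locally Hölder and positive on ℝ^N∖{0},
0 ≤ V(x) - |x|⁻² ≤ c₀, and limsup_{|x|→∞} V(x)|x|² = α. -/
def AssumpV (N : ℕ) (V : Euc N → ℝ) (α : ℝ) : Prop :=
  (∃ γ : ℝ, 0 < γ ∧ γ < 1 ∧ LocHolderOn γ {x : Euc N | x ≠ 0} V) ∧
  (∀ x : Euc N, x ≠ 0 → 0 < V x) ∧
  (∃ c₀ : ℝ, 0 < c₀ ∧ ∀ x : Euc N, x ≠ 0 →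
    0 ≤ V x - ‖x‖ ^ (-2 : ℝ) ∧ V x - ‖x‖ ^ (-2 : ℝ) ≤ c₀) ∧
  limsup (fun x : Euc N => V x * ‖x‖ ^ 2) (normAtTop N) = α

/-- Assumption (Ṽ): V is locally Hölder and positive on ℝ^N∖{0},
0 ≤ V(x) - |x|⁻² ≤ c₀, and liminf_{|x|→∞} V(x)|x|² = β. -/
def AssumpVtilde (N : ℕ) (V : Euc N → ℝ) (β : ℝ) : Prop :=
  (∃ γ : ℝ, 0 < γ ∧ γ < 1 ∧ LocHolderOn γ {x : Euc N | x ≠ 0} V) ∧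
  (∀ x : Euc N, x ≠ 0 → 0 < V x) ∧
  (∃ c₀ : ℝ, 0 < c₀ ∧ ∀ x : Euc N, x ≠ 0 →
    0 ≤ V x - ‖x‖ ^ (-2 : ℝ) ∧ V x - ‖x‖ ^ (-2 : ℝ) ≤ c₀) ∧
  liminf (fun x : Euc N => V x * ‖x‖ ^ 2) (normAtTop N) = β

/-- The potential V_ρ(x) = |x|⁻²(1 + ρ|x|²)/(1 + |x|²). -/
def Vrho (N : ℕ) (ρ : ℝ) (x : Euc N) : ℝ :=
  ‖x‖ ^ (-2 : ℝ) * (1 + ρ * ‖x‖ ^ 2) / (1 + ‖x‖ ^ 2)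

/-- Ω has C² boundary: it is the sublevel set of a C² function whose differential
does not vanish on the boundary. -/
def HasC2Boundary {N : ℕ} (Ω : Set (Euc N)) : Prop :=
  ∃ φ : Euc N → ℝ, ContDiff ℝ 2 φ ∧ Ω = {x | φ x < 0} ∧
    ∀ x ∈ frontier Ω, fderiv ℝ φ x ≠ 0

/-- The Gamma integral in the inverted variable:
`∫₀^∞ q^{-c-1} e^{-r/q} dq = Γ(c) r^{-c}`. -/
lemma lintegral_rpow_mul_exp_neg_div {c r : ℝ} (hc : 0 < c) (hr : 0 < r) :
    ∫⁻ q in Set.Ioi (0 : ℝ), ENNReal.ofReal (q ^ (-c - 1) * Real.exp (-r / q)) =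
      ENNReal.ofReal (Real.Gamma c * r ^ (-c)) := by
  have hval : ∫ q in Set.Ioi (0 : ℝ), q ^ (-c - 1) * Real.exp (-r / q) =
      Real.Gamma c * r ^ (-c) := by
    have h := integral_comp_rpow_Ioi
      (fun t : ℝ => t ^ (c - 1) * Real.exp (-(r * t))) (p := -1) (by norm_num)
    rw [Real.integral_rpow_mul_exp_neg_mul_Ioi hc hr] at h
    rw [Real.rpow_neg hr.le, ← Real.inv_rpow hr.le, mul_comm, ← one_div, ← h]
    refine setIntegral_congr_fun measurableSet_Ioi fun q hq => ?_
    have hq : 0 < q := hq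
    have hpow : q ^ (-c - 1) = q ^ (-1 - 1 : ℝ) * (q ^ (-1 : ℝ)) ^ (c - 1) := by
      rw [← Real.rpow_mul hq.le, ← Real.rpow_add hq]
      ring_nf
    simp only [smul_eq_mul, hpow, abs_neg, abs_one, one_mul, Real.rpow_neg_one]
    rw [mul_assoc, neg_div, div_eq_mul_inv]
  have hpos : 0 < Real.Gamma c * r ^ (-c) :=
    mul_pos (Real.Gamma_pos_of_pos hc) (Real.rpow_pos_of_pos hr _)
  rw [← hval]
  refine (ofReal_integral_eq_lintegral_ofReal ?_ ?_).symm
  · exact Integrable.of_integral_ne_zero (by rw [hval]; exact hpos.ne')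
  · filter_upwards [ae_restrict_mem measurableSet_Ioi] with q hq
    exact mul_nonneg (Real.rpow_nonneg (le_of_lt hq) _) (Real.exp_pos _).le

/-- The convolution of two centred Gaussians. -/
lemma lintegral_gaussian_mul_gaussian {V : Type*} [NormedAddCommGroup V]
    [InnerProductSpace ℝ V] [FiniteDimensional ℝ V] [MeasurableSpace V] [BorelSpace V]
    {p q : ℝ} (hp : 0 < p) (hq : 0 < q) (x : V) :
    ∫⁻ y : V, ENNReal.ofReal (Real.exp (-‖y‖ ^ 2 / p) * Real.exp (-‖x - y‖ ^ 2 / q)) =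
      ENNReal.ofReal ((Real.pi * (p * q / (p + q))) ^ (Module.finrank ℝ V / 2 : ℝ) *
        Real.exp (-‖x‖ ^ 2 / (p + q))) := by
  have hb : 0 < (p + q) / (p * q) := by positivity
  have hsq (y : V) : Real.exp (-‖y‖ ^ 2 / p) * Real.exp (-‖x - y‖ ^ 2 / q) =
      Real.exp (-((p + q) / (p * q)) * ‖y - (p / (p + q)) • x‖ ^ 2) *
        Real.exp (-‖x‖ ^ 2 / (p + q)) := by
    rw [← Real.exp_add, ← Real.exp_add, norm_sub_sq_real, norm_sub_sq_real, norm_smul,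
      inner_smul_right, real_inner_comm, Real.norm_of_nonneg (by positivity)]
    congr 1
    field_simp
    ring
  have hval : ∫ y : V, Real.exp (-‖y‖ ^ 2 / p) * Real.exp (-‖x - y‖ ^ 2 / q) =
      (Real.pi * (p * q / (p + q))) ^ (Module.finrank ℝ V / 2 : ℝ) *
        Real.exp (-‖x‖ ^ 2 / (p + q)) := by
    simp_rw [hsq]
    rw [integral_mul_const,
      integral_sub_right_eq_self (fun y : V => Real.exp (-((p + q) / (p * q)) * ‖y‖ ^ 2)),
      GaussianFourier.integral_rexp_neg_mul_sq_norm hb]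
    congr 2
    field_simp
  rw [← hval]
  refine (ofReal_integral_eq_lintegral_ofReal ?_ ?_).symm
  · refine Integrable.of_integral_ne_zero ?_
    rw [hval]
    positivity
  · exact ae_of_all _ fun y => by positivity

/-- Integrating a power against a function of the sum of two positive variables. -/
lemma lintegral_rpow_mul_comp_add {α : ℝ} (hα : 0 < α) {g : ℝ → ENNReal}
    (hg : Measurable g) :
    ∫⁻ p in Set.Ioi (0 : ℝ), ∫⁻ q in Set.Ioi (0 : ℝ),
        ENNReal.ofReal (p ^ (α - 1)) * g (p + q) =
      ∫⁻ u in Set.Ioi (0 : ℝ), ENNReal.ofReal (u ^ α / α) * g u := by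
  have hpow (u : ℝ) (hu : 0 < u) :
      ∫⁻ p in Set.Ioo 0 u, ENNReal.ofReal (p ^ (α - 1)) = ENNReal.ofReal (u ^ α / α) := by
    have hint : IntervalIntegrable (fun p : ℝ => p ^ (α - 1)) volume 0 u :=
      intervalIntegral.intervalIntegrable_rpow' (by linarith)
    rw [intervalIntegrable_iff_integrableOn_Ioo_of_le hu.le] at hint
    rw [← ofReal_integral_eq_lintegral_ofReal hint, ← integral_Ioc_eq_integral_Ioo,
      ← intervalIntegral.integral_of_le hu.le, integral_rpow (Or.inl (by linarith))]
    · simp [hα.ne']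
    · filter_upwards [ae_restrict_mem measurableSet_Ioo] with p hp
      exact Real.rpow_nonneg hp.1.le _
  have hshift (p : ℝ) : ∫⁻ q in Set.Ioi (0 : ℝ), g (p + q) = ∫⁻ u in Set.Ioi p, g u := by
    rw [← lintegral_indicator measurableSet_Ioi, ← lintegral_indicator measurableSet_Ioi,
      ← lintegral_add_left_eq_self ((Set.Ioi p).indicator g) p]
    congr 1 with q
    simp [Set.indicator_apply]
  calc
    _ = ∫⁻ p in Set.Ioi (0 : ℝ), ∫⁻ u,
          ENNReal.ofReal (p ^ (α - 1)) * (Set.Ioi p).indicator g u := by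
      refine lintegral_congr fun p => ?_
      rw [lintegral_const_mul _ (by fun_prop), hshift,
        lintegral_const_mul _ (hg.indicator measurableSet_Ioi),
        lintegral_indicator measurableSet_Ioi]
    _ = ∫⁻ p, ∫⁻ u, {z : ℝ × ℝ | 0 < z.1 ∧ z.1 < z.2}.indicator
          (fun z => ENNReal.ofReal (z.1 ^ (α - 1)) * g z.2) (p, u) := by
      rw [← lintegral_indicator measurableSet_Ioi]
      refine lintegral_congr fun p => ?_
      by_cases hp : 0 < p
      · simp [Set.indicator_apply, hp]
      · simp [Set.indicator_apply, hp]
    _ = ∫⁻ u, ∫⁻ p, {z : ℝ × ℝ | 0 < z.1 ∧ z.1 < z.2}.indicator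
          (fun z => ENNReal.ofReal (z.1 ^ (α - 1)) * g z.2) (p, u) := by
      refine lintegral_lintegral_swap (Measurable.aemeasurable ?_)
      refine Measurable.indicator (by fun_prop) ?_
      exact (measurableSet_lt measurable_const measurable_fst).inter
        (measurableSet_lt measurable_fst measurable_snd)
    _ = _ := by
      rw [← lintegral_indicator measurableSet_Ioi]
      refine lintegral_congr fun u => ?_
      by_cases hu : 0 < u
      · rw [Set.indicator_of_mem (show u ∈ Set.Ioi 0 from hu), ← hpow u hu,
          ← lintegral_mul_const _ (by fun_prop), ← lintegral_indicator measurableSet_Ioo]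
        rfl
      · rw [Set.indicator_of_notMem (show u ∉ Set.Ioi 0 from hu)]
        simp only [Set.indicator_apply]
        convert lintegral_zero with p
        rw [if_neg]
        rintro ⟨h1, h2⟩
        exact hu (h1.trans h2)

/-- The Newtonian potential of a homogeneous function `‖y‖^{-a}` with `2 < a < dim V`. -/
lemma lintegral_rpow_norm_mul_newtonian {V : Type*} [NormedAddCommGroup V]
    [InnerProductSpace ℝ V] [FiniteDimensional ℝ V] [MeasurableSpace V] [BorelSpace V]
    {a : ℝ} (ha : 2 < a) (had : a < Module.finrank ℝ V) {x : V} (hx : x ≠ 0) :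
    ∫⁻ y : V, ENNReal.ofReal (‖y‖ ^ (-a) * ‖x - y‖ ^ (2 - (Module.finrank ℝ V : ℝ))) =
      ENNReal.ofReal (4 * Real.pi ^ (Module.finrank ℝ V / 2 : ℝ) /
        (Real.Gamma (Module.finrank ℝ V / 2 - 1) * (Module.finrank ℝ V - a) * (a - 2)) *
          ‖x‖ ^ (2 - a)) := by
  set d : ℝ := (Module.finrank ℝ V : ℝ) with hd
  set ν : Measure ℝ := volume.restrict (Set.Ioi 0) with hν
  have : Nontrivial V := ⟨x, 0, hx⟩
  have hΓ : 0 < Real.Gamma (a / 2) * Real.Gamma (d / 2 - 1) :=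
    mul_pos (Real.Gamma_pos_of_pos (by linarith)) (Real.Gamma_pos_of_pos (by linarith))
  have hxn : 0 < ‖x‖ := norm_pos_iff.2 hx
  have hnorm (v : V) (hv : v ≠ 0) {c : ℝ} (hc : 0 < c) :
      ∫⁻ q, ENNReal.ofReal (q ^ (-c - 1) * Real.exp (-‖v‖ ^ 2 / q)) ∂ν =
        ENNReal.ofReal (Real.Gamma c * ‖v‖ ^ (-(2 * c))) := by
    have hv : 0 < ‖v‖ := norm_pos_iff.2 hv
    rw [hν, lintegral_rpow_mul_exp_neg_div hc (by positivity), ← Real.rpow_natCast,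
      ← Real.rpow_mul hv.le]
    norm_num
  have hmix : ∀ᵐ y : V, ENNReal.ofReal (Real.Gamma (a / 2) * Real.Gamma (d / 2 - 1)) *
      ENNReal.ofReal (‖y‖ ^ (-a) * ‖x - y‖ ^ (2 - d)) =
      ∫⁻ z : ℝ × ℝ, ENNReal.ofReal (z.1 ^ (-(a / 2) - 1) * Real.exp (-‖y‖ ^ 2 / z.1)) *
        ENNReal.ofReal (z.2 ^ (-(d / 2 - 1) - 1) * Real.exp (-‖x - y‖ ^ 2 / z.2))
          ∂(ν.prod ν) := by
    filter_upwards [Measure.ae_ne volume 0, Measure.ae_ne volume x] with y hy0 hyx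
    rw [lintegral_prod_mul
        (f := fun p => ENNReal.ofReal (p ^ (-(a / 2) - 1) * Real.exp (-‖y‖ ^ 2 / p)))
        (g := fun q => ENNReal.ofReal (q ^ (-(d / 2 - 1) - 1) * Real.exp (-‖x - y‖ ^ 2 / q)))
        (by fun_prop) (by fun_prop), hnorm y hy0 (by linarith),
      hnorm (x - y) (sub_ne_zero.2 hyx.symm) (by linarith),
      ← ENNReal.ofReal_mul hΓ.le, ← ENNReal.ofReal_mul (by positivity)]
    congr 1
    rw [show -(2 * (a / 2)) = -a by ring, show -(2 * (d / 2 - 1)) = 2 - d by ring]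
    ring
  have hgauss (p q : ℝ) (hp : 0 < p) (hq : 0 < q) :
      ∫⁻ y : V, ENNReal.ofReal (p ^ (-(a / 2) - 1) * Real.exp (-‖y‖ ^ 2 / p)) *
        ENNReal.ofReal (q ^ (-(d / 2 - 1) - 1) * Real.exp (-‖x - y‖ ^ 2 / q)) =
      ENNReal.ofReal (Real.pi ^ (d / 2)) * (ENNReal.ofReal (p ^ ((d - a) / 2 - 1)) *
        ENNReal.ofReal ((p + q) ^ (-(d / 2)) * Real.exp (-‖x‖ ^ 2 / (p + q)))) := by
    have hsplit (y : V) : ENNReal.ofReal (p ^ (-(a / 2) - 1) * Real.exp (-‖y‖ ^ 2 / p)) *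
        ENNReal.ofReal (q ^ (-(d / 2 - 1) - 1) * Real.exp (-‖x - y‖ ^ 2 / q)) =
        ENNReal.ofReal (p ^ (-(a / 2) - 1) * q ^ (-(d / 2 - 1) - 1)) *
          ENNReal.ofReal (Real.exp (-‖y‖ ^ 2 / p) * Real.exp (-‖x - y‖ ^ 2 / q)) := by
      rw [← ENNReal.ofReal_mul (by positivity), ← ENNReal.ofReal_mul (by positivity)]
      ring_nf
    simp_rw [hsplit]
    rw [lintegral_const_mul _ (by fun_prop), lintegral_gaussian_mul_gaussian hp hq,
      ← ENNReal.ofReal_mul (by positivity), ← ENNReal.ofReal_mul (by positivity),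
      ← ENNReal.ofReal_mul (by positivity), ← hd]
    congr 1
    rw [Real.mul_rpow Real.pi_pos.le (by positivity), Real.div_rpow (by positivity)
      (by positivity), Real.mul_rpow hp.le hq.le, Real.rpow_neg (by positivity),
      show (d - a) / 2 - 1 = (-(a / 2) - 1) + d / 2 by ring, Real.rpow_add hp,
      show -(d / 2 - 1) - 1 = -(d / 2) by ring, Real.rpow_neg hq.le]
    field_simp
  have hradial : ∫⁻ u in Set.Ioi (0 : ℝ), ENNReal.ofReal (u ^ ((d - a) / 2) / ((d - a) / 2)) *
      ENNReal.ofReal (u ^ (-(d / 2)) * Real.exp (-‖x‖ ^ 2 / u)) =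
      ENNReal.ofReal (((d - a) / 2)⁻¹) *
        ENNReal.ofReal (Real.Gamma (a / 2 - 1) * ‖x‖ ^ (2 - a)) := by
    rw [show 2 - a = -(2 * (a / 2 - 1)) by ring, ← hnorm x hx (by linarith),
      ← lintegral_const_mul _ (by fun_prop)]
    refine setLIntegral_congr_fun measurableSet_Ioi fun u hu => ?_
    have hu : 0 < u := hu
    have hda : 0 < d - a := by linarith
    rw [← ENNReal.ofReal_mul (by positivity), ← ENNReal.ofReal_mul (by positivity),
      show -(a / 2 - 1) - 1 = (d - a) / 2 + -(d / 2) by ring, Real.rpow_add hu]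
    congr 1
    ring
  have hprod : ENNReal.ofReal (Real.Gamma (a / 2) * Real.Gamma (d / 2 - 1)) *
      ∫⁻ y : V, ENNReal.ofReal (‖y‖ ^ (-a) * ‖x - y‖ ^ (2 - d)) =
      ENNReal.ofReal (Real.pi ^ (d / 2)) * (ENNReal.ofReal (((d - a) / 2)⁻¹) *
        ENNReal.ofReal (Real.Gamma (a / 2 - 1) * ‖x‖ ^ (2 - a))) := by
    rw [← lintegral_const_mul _ (by fun_prop), lintegral_congr_ae hmix,
      lintegral_lintegral_swap (by fun_prop),
      lintegral_prod _ (Measurable.aemeasurable (by fun_prop)), ← hradial,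
      ← lintegral_rpow_mul_comp_add (by linarith) (by fun_prop),
      ← lintegral_const_mul _ (by fun_prop)]
    refine setLIntegral_congr_fun measurableSet_Ioi fun p hp => ?_
    rw [← lintegral_const_mul _ (by fun_prop)]
    exact setLIntegral_congr_fun measurableSet_Ioi fun q hq => hgauss p q hp hq
  have hne : ENNReal.ofReal (Real.Gamma (a / 2) * Real.Gamma (d / 2 - 1)) ≠ 0 := by
    simpa using hΓ
  rw [← ENNReal.mul_right_inj hne ENNReal.ofReal_ne_top, hprod,
    ← ENNReal.ofReal_mul (by have : 0 < d - a := by linarith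
                             positivity),
    ← ENNReal.ofReal_mul (by positivity), ← ENNReal.ofReal_mul hΓ.le]
  congr 1
  have hG : Real.Gamma (a / 2) = (a / 2 - 1) * Real.Gamma (a / 2 - 1) := by
    rw [← Real.Gamma_add_one (by linarith), sub_add_cancel]
  have h1 : Real.Gamma (d / 2 - 1) ≠ 0 := (Real.Gamma_pos_of_pos (by linarith)).ne'
  have h2 : d - a ≠ 0 := by linarith
  have h3 : a - 2 ≠ 0 := by linarith
  rw [hG]
  generalize Real.Gamma (d / 2 - 1) = G at h1
  generalize Real.Gamma (a / 2 - 1) = G'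
  field_simp
  ring

/-- The area of the unit sphere in terms of the Gamma function. -/
lemma sphereArea_eq {N : ℕ} (hN : 3 ≤ N) :
    ((N : ℝ) - 2) * sphereArea N =
      4 * Real.pi ^ (N / 2 : ℝ) / Real.Gamma (N / 2 - 1) := by
  have : Nonempty (Fin N) := ⟨⟨0, by omega⟩⟩
  have hN' : (3 : ℝ) ≤ N := by exact_mod_cast hN
  have hG : Real.Gamma ((N : ℝ) / 2 + 1) =
      (N / 2) * ((N / 2 - 1) * Real.Gamma (N / 2 - 1)) := by
    rw [Real.Gamma_add_one (by positivity), ← Real.Gamma_add_one (s := (N : ℝ) / 2 - 1)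
      (by linarith), sub_add_cancel]
  have hΓ : 0 < Real.Gamma ((N : ℝ) / 2 - 1) := Real.Gamma_pos_of_pos (by linarith)
  have hN2 : (N : ℝ) - 2 ≠ 0 := by linarith
  have hpi : √Real.pi ^ N = Real.pi ^ (N / 2 : ℝ) := by
    rw [Real.sqrt_eq_rpow, ← Real.rpow_natCast, ← Real.rpow_mul Real.pi_pos.le]
    ring_nf
  rw [sphereArea, EuclideanSpace.volume_ball, ENNReal.ofReal_one, one_pow, one_mul,
    Fintype.card_fin, hpi, ENNReal.toReal_ofReal
      (div_nonneg (by positivity) (Real.Gamma_pos_of_pos (by positivity)).le), hG]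
  field_simp
  ring

/-- Identity (2.14): Φ_μ = μ𝔾_{ℝ^N}[|·|⁻²Φ_μ], with the integral finite for x ≠ 0. -/
theorem Phi_is_newtonian_potential
    (N : ℕ) (hN : 3 ≤ N) (μ : ℝ) (hμ : 0 < μ) (hμ0 : μ < mu0 N) :
    ∀ x : Euc N, x ≠ 0 →
      (∫⁻ y : Euc N,
        ENNReal.ofReal (‖y‖ ^ (tauMinus N μ - 2) * ‖x - y‖ ^ ((2 : ℝ) - N)) < ⊤) ∧
      ‖x‖ ^ tauMinus N μ =
        μ * cN N * ∫ y : Euc N, ‖y‖ ^ (tauMinus N μ - 2) * ‖x - y‖ ^ ((2 : ℝ) - N) := by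
  intro x hx
  have hN' : (3 : ℝ) ≤ N := by exact_mod_cast hN
  set s := Real.sqrt (mu0 N - μ) with hs
  have hs0 : 0 < s := Real.sqrt_pos.2 (by linarith)
  have hsq : s ^ 2 = ((N : ℝ) - 2) ^ 2 / 4 - μ := Real.sq_sqrt (by linarith)
  have hτ : tauMinus N μ = -((N : ℝ) - 2) / 2 - s := rfl
  have hs1 : s < ((N : ℝ) - 2) / 2 := by nlinarith
  have hroot : ((N : ℝ) - 2 + tauMinus N μ) * -tauMinus N μ = μ := by
    rw [hτ]
    linear_combination -hsq
  have hxn : 0 < ‖x‖ := norm_pos_iff.2 hx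
  have hlint : ∫⁻ y : Euc N,
      ENNReal.ofReal (‖y‖ ^ (tauMinus N μ - 2) * ‖x - y‖ ^ ((2 : ℝ) - N)) =
      ENNReal.ofReal (((N : ℝ) - 2) * sphereArea N / μ * ‖x‖ ^ tauMinus N μ) := by
    have h := lintegral_rpow_norm_mul_newtonian (V := Euc N) (a := 2 - tauMinus N μ)
      (by linarith) (by rw [finrank_euclideanSpace_fin]; linarith) hx
    rw [finrank_euclideanSpace_fin, mul_assoc (Real.Gamma _),
      show ((N : ℝ) - (2 - tauMinus N μ)) * (2 - tauMinus N μ - 2) = μ by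
        linear_combination hroot,
      neg_sub, sub_sub_cancel] at h
    rw [sphereArea_eq hN, div_div, h]
  refine ⟨hlint ▸ ENNReal.ofReal_lt_top, ?_⟩
  have hpos : 0 < ((N : ℝ) - 2) * sphereArea N := by
    rw [sphereArea_eq hN]
    exact div_pos (by positivity) (Real.Gamma_pos_of_pos (by linarith))
  rw [integral_eq_lintegral_of_nonneg_ae (ae_of_all _ fun y => by positivity)
    (Measurable.aestronglyMeasurable (by fun_prop)), hlint,
    ENNReal.toReal_ofReal (by positivity), cN]
  rw [div_mul_eq_mul_div, mul_div_assoc', mul_assoc μ, inv_mul_cancel_left₀ hpos.ne',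
    mul_div_cancel_left₀ _ hμ.ne']
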